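/- arXiv:2002.03573 — 4 statements merged into one kernel-verified Lean document; each statement's English description precedes it below -/
import Mathlib

section
/- If κ is a measurable cardinal then there exists a partition ⟨S_γ : γ < κ⟩ of κ into κ-many pairwise disjoint stationary subsets of κ such that the weak diamond Φ_{S_γ} holds for every γ < κ. -/
noncomputable section

open Cardinal Set

namespace WDP

/-- `S` is an unbounded subset of the ordinals below `o`: `sup S = o`. -/
def IsUnboundedIn (o : Ordinal) (S : Set Ordinal) : Prop :=
  S ⊆ Set.Iio o ∧ sSup S = o

/-- `C` is a club (closed unbounded) subset of the ordinals below `o`. -/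
def IsClubIn (o : Ordinal) (C : Set Ordinal) : Prop :=
  IsUnboundedIn o C ∧ ∀ s ⊆ C, s.Nonempty → sSup s < o → sSup s ∈ C

/-- `S` is a stationary subset of the ordinals below `o`. -/
def IsStationaryIn (o : Ordinal) (S : Set Ordinal) : Prop :=
  S ⊆ Set.Iio o ∧ ∀ C, IsClubIn o C → (S ∩ C).Nonempty

/-- A coloring `c : 2^{<o} → 2`. -/
def Coloring (o : Ordinal) :=
  (α : Set.Iio o) → (Set.Iio α.1 → Bool) → Bool

/-- The restriction `f ↾ α` of `f : o → 2` to `α < o`. -/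
def restr {o : Ordinal} (f : Set.Iio o → Bool) (α : Set.Iio o) : Set.Iio α.1 → Bool :=
  fun β => f ⟨β.1, Set.mem_Iio.mpr ((Set.mem_Iio.mp β.2).trans (Set.mem_Iio.mp α.2))⟩

/-- The set `{α < o : c (f ↾ α) = g α}`. -/
def guessSet (o : Ordinal) (c : Coloring o) (f g : Set.Iio o → Bool) : Set Ordinal :=
  {β | ∃ h : β < o, c ⟨β, h⟩ (restr f ⟨β, h⟩) = g ⟨β, h⟩}

/-- The weak diamond `Φ_S` on a set `S` of ordinals below `o`. -/
def WeakDiamondOn (o : Ordinal) (S : Set Ordinal) : Prop :=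
  ∀ c : Coloring o, ∃ g : Set.Iio o → Bool, ∀ f : Set.Iio o → Bool,
    IsStationaryIn o (guessSet o c f g ∩ S)

/-- The weak diamond `Φ_o`. -/
def WeakDiamond (o : Ordinal) : Prop :=
  ∀ c : Coloring o, ∃ g : Set.Iio o → Bool, ∀ f : Set.Iio o → Bool,
    IsStationaryIn o (guessSet o c f g)

/-- The very weak diamond `Ψ_o`. -/
def VeryWeakDiamond (o : Ordinal) : Prop :=
  ∀ c : Coloring o, ∃ g : Set.Iio o → Bool, ∀ f : Set.Iio o → Bool,
    IsUnboundedIn o (guessSet o c f g)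

/-- The diamond principle `◊_o`. -/
def Diamond (o : Ordinal) : Prop :=
  ∃ A : Set.Iio o → Set Ordinal,
    (∀ α : Set.Iio o, A α ⊆ Set.Iio α.1) ∧
    ∀ X : Set Ordinal, X ⊆ Set.Iio o →
      IsStationaryIn o {β | ∃ h : β < o, A ⟨β, h⟩ = X ∩ Set.Iio β}

/-- `κ` is a measurable cardinal: it is uncountable and carries a κ-complete
nonprincipal ultrafilter. -/
def IsMeasurableCard (κ : Cardinal) : Prop :=
  Cardinal.aleph0 < κ ∧
  ∃ U : Ultrafilter (Set.Iio κ.ord),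
    (∀ α : Set.Iio κ.ord, ({α}ᶜ : Set (Set.Iio κ.ord)) ∈ U) ∧
    ∀ (τ : Ordinal), τ < κ.ord → ∀ s : Set.Iio τ → Set (Set.Iio κ.ord),
      (∀ i, s i ∈ U) → (⋂ i, s i) ∈ U

/-- The parametrized weak diamond `θ-Φ_κ`. -/
def ParamWeakDiamond (κ : Cardinal) (θ : Cardinal) : Prop :=
  ∀ c : Coloring κ.ord, ∃ g : Set.Iio θ.ord → (Set.Iio κ.ord → Bool),
    ∀ f : Set.Iio κ.ord → Bool, ∃ τ, IsStationaryIn κ.ord (guessSet κ.ord c f (g τ))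

/-- A `κ`-complete ultrafilter on the ordinals below `κ` satisfies fewer than `κ` many
large conditions simultaneously. -/
theorem eventually_forall_lt {κ : Cardinal} {U : Ultrafilter (Set.Iio κ.ord)}
    (hU : ∀ (τ : Ordinal), τ < κ.ord → ∀ s : Set.Iio τ → Set (Set.Iio κ.ord),
      (∀ i, s i ∈ U) → (⋂ i, s i) ∈ U)
    {τ : Ordinal} (hτ : τ < κ.ord) {P : Ordinal → Set.Iio κ.ord → Prop}
    (hP : ∀ i < τ, ∀ᶠ x in (U : Filter _), P i x) :
    ∀ᶠ x in (U : Filter _), ∀ i < τ, P i x := by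
  have h := hU τ hτ (fun i => {x | P i.1 x}) (fun i => hP i.1 i.2)
  filter_upwards [h] with x hx i hi
  exact Set.mem_iInter.mp hx ⟨i, hi⟩

/-- The order of the ultrapower of the ordinals by a countably complete ultrafilter is
well-founded. -/
theorem wellFounded_eventually_lt {κ : Cardinal} (hκ : Cardinal.aleph0 < κ)
    {U : Ultrafilter (Set.Iio κ.ord)}
    (hU : ∀ (τ : Ordinal), τ < κ.ord → ∀ s : Set.Iio τ → Set (Set.Iio κ.ord),
      (∀ i, s i ∈ U) → (⋂ i, s i) ∈ U) :
    WellFounded (fun f g : Set.Iio κ.ord → Ordinal => ∀ᶠ x in (U : Filter _), f x < g x) := by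
  rw [wellFounded_iff_isEmpty_descending_chain]
  refine ⟨fun ⟨f, hf⟩ => ?_⟩
  have hω : Ordinal.omega0 < κ.ord := by
    rw [← Cardinal.ord_aleph0]
    exact Cardinal.ord_lt_ord.mpr hκ
  have h := eventually_forall_lt hU hω
    (P := fun i x => ∀ n : ℕ, i = n → f (n + 1) x < f n x) (by
      intro i hi
      obtain ⟨n, rfl⟩ := Ordinal.lt_omega0.mp hi
      filter_upwards [hf n] with x hx m hm
      rw [← Nat.cast_injective hm]
      exact hx)
  obtain ⟨x, hx⟩ := h.exists
  exact (wellFounded_iff_isEmpty_descending_chain.mp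
    (wellFounded_lt (α := Ordinal))).false
    ⟨fun n => f n x, fun n => hx n (Ordinal.natCast_lt_omega0 n) n rfl⟩

/-- A measurable cardinal carries a normal ultrafilter, here regarded as an ultrafilter on the
class of all ordinals. -/
theorem IsMeasurableCard.exists_normal {κ : Cardinal} (hκ : IsMeasurableCard κ) :
    ∃ W : Ultrafilter Ordinal, (∀ᶠ α in (W : Filter _), α < κ.ord) ∧
      (∀ γ < κ.ord, ∀ᶠ α in (W : Filter _), γ < α) ∧
      ∀ f : Ordinal → Ordinal, (∀ᶠ α in (W : Filter _), f α < α) →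
        ∃ γ, ∀ᶠ α in (W : Filter _), f α = γ := by
  obtain ⟨hκ, U, hne, hU⟩ := hκ
  have hsucc : ∀ γ < κ.ord, Order.succ γ < κ.ord :=
    fun γ hγ => (Cardinal.isSuccLimit_ord hκ.le).succ_lt hγ
  let T : Set (Set.Iio κ.ord → Ordinal) :=
    {f | (∀ᶠ x in (U : Filter _), f x < κ.ord) ∧
      ∀ γ < κ.ord, ∀ᶠ x in (U : Filter _), γ < f x}
  have hT : T.Nonempty := by
    refine ⟨fun x => x.1, Filter.Eventually.of_forall fun x => x.2, fun γ hγ => ?_⟩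
    have h := eventually_forall_lt hU (hsucc γ hγ) (P := fun i x => x.1 ≠ i) (by
      intro i hi
      filter_upwards [hne ⟨i, hi.trans (hsucc γ hγ)⟩] with x hx hxi
      exact hx (Subtype.ext hxi))
    filter_upwards [h] with x hx
    by_contra! hle
    exact hx x.1 (Order.lt_succ_of_le hle) rfl
  have wf := wellFounded_eventually_lt hκ hU
  obtain ⟨φ, ⟨hφκ, hφ⟩, hmin⟩ := wf.has_min T hT
  refine ⟨U.map φ, hφκ, hφ, fun f hf => ?_⟩
  have hf' : ∀ᶠ x in (U : Filter _), f (φ x) < φ x := hf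
  have hlt : ∀ᶠ x in (U : Filter _), f (φ x) < κ.ord := by
    filter_upwards [hf', hφκ] with x h₁ h₂ using h₁.trans h₂
  have hnot : ¬ ∀ γ < κ.ord, ∀ᶠ x in (U : Filter _), γ < f (φ x) :=
    fun h => hmin (fun x => f (φ x)) ⟨hlt, h⟩ hf'
  push Not at hnot
  obtain ⟨γ, hγ, hγf⟩ := hnot
  by_contra! hconst
  have h := eventually_forall_lt hU (hsucc γ hγ) (P := fun i x => f (φ x) ≠ i) (by
    intro i _
    exact hconst i)
  obtain ⟨x, h₁, h₂⟩ := (h.and hγf).exists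
  exact h₁ _ (Order.lt_succ_of_le h₂) rfl

/-- A normal ultrafilter witnesses ineffability. -/
theorem exists_eventually_inter_Iio_eq {W : Ultrafilter Ordinal}
    (hW : ∀ f : Ordinal → Ordinal, (∀ᶠ α in (W : Filter _), f α < α) →
      ∃ γ, ∀ᶠ α in (W : Filter _), f α = γ)
    (A : Ordinal → Set Ordinal) :
    ∃ X : Set Ordinal, ∀ᶠ α in (W : Filter _), A α ∩ Set.Iio α = X ∩ Set.Iio α := by
  classical
  let X : Set Ordinal := {ξ | ∀ᶠ α in (W : Filter _), ξ ∈ A α}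
  refine ⟨X, ?_⟩
  by_contra hcon
  rw [← Ultrafilter.eventually_not] at hcon
  have hex : ∀ α, ∃ ξ, A α ∩ Set.Iio α ≠ X ∩ Set.Iio α → ξ < α ∧ ¬ (ξ ∈ A α ↔ ξ ∈ X) := by
    intro α
    by_contra! h
    refine (h 0).1 (Set.ext fun ξ => ?_)
    have hξ := (h ξ).2
    simp only [Set.mem_inter_iff, Set.mem_Iio]
    tauto
  choose d hd using hex
  obtain ⟨ξ, hξ⟩ := hW d (hcon.mono fun α h => (hd α h).1)
  have hne : ∀ᶠ α in (W : Filter _), ¬ (ξ ∈ A α ↔ ξ ∈ X) := by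
    filter_upwards [hcon, hξ] with α h₁ h₂
    exact h₂ ▸ (hd α h₁).2
  by_cases hX : ξ ∈ X
  · obtain ⟨α, h₁, h₂⟩ := (hne.and hX).exists
    exact h₁ ⟨fun _ => hX, fun _ => h₂⟩
  · refine hX ?_
    filter_upwards [hne] with α h₁
    tauto

/-- A club reflects to a club below almost every ordinal of a normal ultrafilter. -/
theorem IsClubIn.eventually_isClubIn_inter_Iio {o : Ordinal} {W : Ultrafilter Ordinal}
    (hWo : ∀ᶠ α in (W : Filter _), α < o)
    (hWgt : ∀ γ < o, ∀ᶠ α in (W : Filter _), γ < α)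
    (hW : ∀ f : Ordinal → Ordinal, (∀ᶠ α in (W : Filter _), f α < α) →
      ∃ γ, ∀ᶠ α in (W : Filter _), f α = γ)
    {C : Set Ordinal} (hC : IsClubIn o C) :
    ∀ᶠ α in (W : Filter _), α < o ∧ IsClubIn α (C ∩ Set.Iio α) := by
  have hbdd : ∀ α : Ordinal, BddAbove (C ∩ Set.Iio α) := fun α => ⟨α, fun x hx => hx.2.le⟩
  have hsup : ∀ᶠ α in (W : Filter _), sSup (C ∩ Set.Iio α) = α := by
    by_contra hcon
    rw [← Ultrafilter.eventually_not] at hcon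
    obtain ⟨γ, hγ⟩ := hW (fun α => sSup (C ∩ Set.Iio α)) (by
      filter_upwards [hcon] with α h
      exact lt_of_le_of_ne (csSup_le' fun x hx => hx.2.le) h)
    have hγo : γ < o := by
      obtain ⟨α, h₁, h₂⟩ := (hγ.and hWo).exists
      rw [← h₁]
      exact (csSup_le' fun x hx => hx.2.le : sSup (C ∩ Set.Iio α) ≤ α).trans_lt h₂
    rw [← hC.1.2] at hγo
    obtain ⟨c, hc, hγc⟩ := exists_lt_of_lt_csSup' hγo
    obtain ⟨α, h₁, h₂⟩ := (hγ.and (hWgt c (hC.1.1 hc))).exists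
    exact hγc.not_ge (h₁ ▸ le_csSup (hbdd α) ⟨hc, h₂⟩)
  filter_upwards [hsup, hWo] with α h hα
  exact ⟨hα, ⟨Set.inter_subset_right, h⟩, fun s hs hne hlt =>
    ⟨hC.2 s (fun x hx => (hs hx).1) hne (hlt.trans hα), hlt⟩⟩

/-- `p` guesses the set `X` and the ordinal `γ` at `β`. -/
def GuessesAt (p : Set Ordinal × Ordinal) (X : Set Ordinal) (γ β : Ordinal) : Prop :=
  p.1 ∩ Set.Iio β = X ∩ Set.Iio β ∧ p.2 = γ

/-- There is a sequence each of whose terms is, whenever possible, a counterexample (together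
with a club) to the guessing property of the earlier terms. -/
theorem exists_diagonal_sequence :
    ∃ A : Ordinal → (Set Ordinal × Ordinal) × Set Ordinal, ∀ α,
      (∃ q : (Set Ordinal × Ordinal) × Set Ordinal, q.1.2 < α ∧ IsClubIn α q.2 ∧
        ∀ β ∈ q.2, ¬ GuessesAt (A β).1 q.1.1 q.1.2 β) →
      (A α).1.2 < α ∧ IsClubIn α (A α).2 ∧
        ∀ β ∈ (A α).2, ¬ GuessesAt (A β).1 (A α).1.1 (A α).1.2 β := by
  classical
  let Q (α : Ordinal) (prev : (β : Ordinal) → β < α → (Set Ordinal × Ordinal) × Set Ordinal)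
      (q : (Set Ordinal × Ordinal) × Set Ordinal) : Prop :=
    q.1.2 < α ∧ IsClubIn α q.2 ∧
      ∀ (β : Ordinal) (h : β < α), β ∈ q.2 → ¬ GuessesAt (prev β h).1 q.1.1 q.1.2 β
  let step (α : Ordinal)
      (prev : (β : Ordinal) → β < α → (Set Ordinal × Ordinal) × Set Ordinal) :
      (Set Ordinal × Ordinal) × Set Ordinal := Classical.epsilon (Q α prev)
  let A := (wellFounded_lt (α := Ordinal)).fix step
  have hA : ∀ α, A α = Classical.epsilon (Q α fun β _ => A β) :=
    fun α => (wellFounded_lt (α := Ordinal)).fix_eq step α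
  refine ⟨A, fun α ⟨q, h₁, h₂, h₃⟩ => ?_⟩
  have hQ : Q α (fun β _ => A β) (A α) := by
    have h := Classical.epsilon_spec (p := Q α fun β _ => A β)
      ⟨q, h₁, h₂, fun β _ hβ => h₃ β hβ⟩
    rwa [← hA α] at h
  exact ⟨hQ.1, hQ.2.1, fun β hβ => hQ.2.2 β (hQ.2.1.1.1 hβ) hβ⟩

/-- On a measurable cardinal there is a diamond sequence guessing sets and ordinals
simultaneously. -/
theorem IsMeasurableCard.exists_guessing_sequence {κ : Cardinal} (hκ : IsMeasurableCard κ) :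
    ∃ A : Ordinal → Set Ordinal × Ordinal, ∀ X, ∀ γ < κ.ord, ∀ C, IsClubIn κ.ord C →
      ∃ α ∈ C, GuessesAt (A α) X γ α := by
  obtain ⟨W, hWκ, hWgt, hW⟩ := hκ.exists_normal
  obtain ⟨A, hA⟩ := exists_diagonal_sequence
  refine ⟨fun α => (A α).1, ?_⟩
  by_contra! hcon
  obtain ⟨X, γ, hγ, C, hC, hXC⟩ := hcon
  have hcex : ∀ᶠ α in (W : Filter _), (A α).1.2 < α ∧ IsClubIn α (A α).2 ∧
      ∀ β ∈ (A α).2, ¬ GuessesAt (A β).1 (A α).1.1 (A α).1.2 β := by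
    filter_upwards [hC.eventually_isClubIn_inter_Iio hWκ hWgt hW, hWgt γ hγ] with α hα hγα
    exact hA α ⟨((X, γ), C ∩ Set.Iio α), hγα, hα.2, fun β hβ => hXC β hβ.1⟩
  obtain ⟨δ, hδ⟩ := hW (fun α => (A α).1.2) (hcex.mono fun α h => h.1)
  obtain ⟨Y, hY⟩ := exists_eventually_inter_Iio_eq hW fun α => (A α).1.1
  obtain ⟨D, hD⟩ := exists_eventually_inter_Iio_eq hW fun α => (A α).2
  have hall := hcex.and (hδ.and (hY.and hD))
  obtain ⟨α, ⟨⟨_, hCα, _⟩, hδα, hYα, hDα⟩, hακ, hα0⟩ := (hall.and (hWκ.and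
    (hWgt 0 (bot_le.trans_lt hγ)))).exists
  obtain ⟨β, ⟨⟨_, hCβ, hβ⟩, hδβ, hYβ, hDβ⟩, hαβ⟩ := (hall.and (hWgt α hακ)).exists
  have restrict : ∀ {P Q : Set Ordinal}, P ∩ Set.Iio β = Q ∩ Set.Iio β →
      P ∩ Set.Iio α = Q ∩ Set.Iio α := by
    intro P Q h
    have hsub : Set.Iio β ∩ Set.Iio α = Set.Iio α :=
      Set.inter_eq_right.mpr (Set.Iio_subset_Iio hαβ.le)
    rw [← hsub, ← Set.inter_assoc, h, Set.inter_assoc]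
  have hsub : (A α).2 ⊆ (A β).2 := by
    intro x hx
    have : x ∈ (A β).2 ∩ Set.Iio α := by
      rw [restrict hDβ, ← hDα]
      exact ⟨hx, hCα.1.1 hx⟩
    exact this.1
  have hne : (A α).2.Nonempty := by
    by_contra! h
    have := hCα.1.2
    rw [h, csSup_empty] at this
    exact hα0.ne this
  have hmem : α ∈ (A β).2 := by
    have := hCβ.2 _ hsub hne (hCα.1.2.trans_lt hαβ)
    rwa [hCα.1.2] at this
  exact hβ α hmem ⟨hYα.trans (restrict hYβ).symm, hδα.trans hδβ.symm⟩

theorem partition_into_weak_diamond_stationary_sets (κ : Cardinal)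
    (hmeas : IsMeasurableCard κ) :
    ∃ S : Set.Iio κ.ord → Set Ordinal,
      (∀ γ γ' : Set.Iio κ.ord, γ ≠ γ' → Disjoint (S γ) (S γ')) ∧
      (⋃ γ : Set.Iio κ.ord, S γ) = Set.Iio κ.ord ∧
      (∀ γ, IsStationaryIn κ.ord (S γ)) ∧
      (∀ γ, WeakDiamondOn κ.ord (S γ)) := by
  classical
  obtain ⟨A, hA⟩ := hmeas.exists_guessing_sequence
  have hpos : 0 < κ.ord := Cardinal.ord_pos.mpr (bot_le.trans_lt hmeas.1)
  let ι (α : Ordinal) : Set.Iio κ.ord :=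
    if h : (A α).2 < κ.ord then ⟨(A α).2, h⟩ else ⟨0, hpos⟩
  have hι : ∀ (γ : Set.Iio κ.ord) (α : Ordinal), (A α).2 = γ → ι α = γ := by
    intro γ α h
    have hlt : (A α).2 < κ.ord := h ▸ γ.2
    simp only [ι, dif_pos hlt]
    exact Subtype.ext h
  refine ⟨fun γ => {α | α < κ.ord ∧ ι α = γ}, ?_, ?_, ?_, ?_⟩
  · intro γ γ' hne
    exact Set.disjoint_left.mpr fun α h h' => hne (h.2.symm.trans h'.2)
  · ext α
    exact ⟨fun h => (Set.mem_iUnion.mp h).choose_spec.1,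
      fun h => Set.mem_iUnion.mpr ⟨ι α, h, rfl⟩⟩
  · refine fun γ => ⟨fun α h => h.1, fun C hC => ?_⟩
    obtain ⟨α, hαC, hα⟩ := hA ∅ γ γ.2 C hC
    exact ⟨α, ⟨hC.1.1 hαC, hι γ α hα.2⟩, hαC⟩
  · intro γ c
    refine ⟨fun α => c α fun β => decide (β.1 ∈ (A α).1),
      fun f => ⟨fun α h => h.2.1, fun C hC => ?_⟩⟩
    obtain ⟨α, hαC, hα⟩ := hA {β | ∃ h : β < κ.ord, f ⟨β, h⟩ = true} γ γ.2 C hC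
    have hακ : α < κ.ord := hC.1.1 hαC
    refine ⟨α, ⟨⟨hακ, congrArg (c ⟨α, hακ⟩) (funext fun β => ?_)⟩, hακ, hι γ α hα.2⟩, hαC⟩
    have hβα : β.1 < α := β.2
    have hβ := Set.ext_iff.mp hα.1 β.1
    simp only [Set.mem_inter_iff, Set.mem_Iio, hβα, and_true, Set.mem_ofPred_eq,
      hβα.trans hακ, exists_true_left] at hβ
    exact Bool.eq_iff_iff.mpr (hβ.symm.trans decide_eq_true_iff.symm)

end WDP
end
end

section
/- Let θ be an uncountable cardinal (so that θ⁺ > ℵ₁). If 2^θ = θ⁺ then the diamond principle ◊_{θ⁺} holds. -/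
noncomputable section

open Cardinal Set

namespace WDP

section ClosurePoints

open Order

universe u v

theorem iSup_Iio_add_one_lt_ord {κ : Cardinal.{u}} (hκ : κ.IsRegular) {ξ : Ordinal.{u}}
    (hξ : ξ < κ.ord) {f : Set.Iio ξ → Ordinal.{u}} (hf : ∀ η, f η < κ.ord) :
    ⨆ η, f η + 1 < κ.ord := by
  refine Ordinal.lift_iSup_add_one_lt_of_lt_cof ?_ hf
  rw [Cardinal.mk_Iio_ordinal, ← Ordinal.lift_cof, hκ.cof_ord]
  rw [Cardinal.lift_lift]
  exact Cardinal.lift_lt.2 (Cardinal.lt_ord.1 hξ)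

/-- Below a regular cardinal `κ`, a self-map of `κ` has closure points of any prescribed regular
cofinality `μ < κ`. -/
theorem exists_closed_of_cof {κ μ : Cardinal.{u}} (hκ : κ.IsRegular) (hμ : μ.IsRegular)
    (hμκ : μ < κ) (f : Ordinal.{u} → Ordinal.{u}) (hf : ∀ y < κ.ord, f y < κ.ord) :
    ∃ δ < κ.ord, δ.cof = μ ∧ ∀ y < δ, f y < δ := by
  let G : Ordinal.{u} → Ordinal.{u} := fun y ↦ ⨆ z : Set.Iio (y + 1), f z + 1
  have hκ' : IsSuccLimit κ.ord := Cardinal.isSuccLimit_ord hκ.aleph0_le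
  have hG : ∀ y < κ.ord, G y < κ.ord := fun y hy ↦
    iSup_Iio_add_one_lt_ord hκ (hκ'.succ_lt hy) fun z ↦
      hf _ (z.2.trans (hκ'.succ_lt hy))
  have hfG : ∀ z y, z ≤ y → f z < G y := fun z y h ↦
    Ordinal.lt_iSup_add_one (fun z : Set.Iio (y + 1) ↦ f z) ⟨z, Order.lt_succ_of_le h⟩
  let x : Ordinal.{u} → Ordinal.{u} := WellFoundedLT.fix
    fun ξ r ↦ ⨆ η : Set.Iio ξ, max (r η.1 η.2) (G (r η.1 η.2)) + 1
  have hx : ∀ ξ, x ξ = ⨆ η : Set.Iio ξ, max (x η) (G (x η)) + 1 := fun ξ ↦ by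
    simp only [x]
    rw [WellFoundedLT.fix_eq]
  have hstep : ∀ η ξ, η < ξ → max (x η) (G (x η)) < x ξ := fun η ξ h ↦ by
    rw [hx ξ]
    exact Ordinal.lt_iSup_add_one (fun η : Set.Iio ξ ↦ max (x η) (G (x η))) ⟨η, h⟩
  have hxκ : ∀ ξ < κ.ord, x ξ < κ.ord := fun ξ ↦ by
    induction ξ using WellFoundedLT.induction with
    | ind ξ ih =>
      intro hξ
      rw [hx]
      refine iSup_Iio_add_one_lt_ord hκ hξ fun η ↦ ?_
      have := ih η.1 η.2 (η.2.trans hξ)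
      exact max_lt this (hG _ this)
  have hmono : StrictMono fun η : Set.Iio μ.ord ↦ x η := fun a b h ↦
    (le_max_left _ _).trans_lt (hstep a b h)
  have hμκ' : μ.ord < κ.ord := Cardinal.ord_lt_ord.2 hμκ
  refine ⟨⨆ η : Set.Iio μ.ord, x η + 1, ?_, ?_, ?_⟩
  · exact iSup_Iio_add_one_lt_ord hκ hμκ' fun η ↦ hxκ _ (η.2.trans hμκ')
  · rw [Ordinal.cof_iSup_Iio_add_one hmono, hμ.cof_ord]
  · intro y hy
    obtain ⟨η, hη⟩ := Ordinal.lt_iSup_add_one_iff.1 hy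
    have hη' : η.1 + 1 < μ.ord := (Cardinal.isSuccLimit_ord hμ.aleph0_le).succ_lt η.2
    calc f y < G (x η) := hfG _ _ hη
      _ < x (η + 1) := (le_max_right _ _).trans_lt (hstep _ _ (Order.lt_succ η.1))
      _ < _ := Ordinal.lt_iSup_add_one (fun η : Set.Iio μ.ord ↦ x η) ⟨η.1 + 1, hη'⟩

theorem IsClubIn.exists_gt {o : Ordinal.{u}} {C : Set Ordinal.{u}} (hC : IsClubIn o C)
    {y : Ordinal.{u}} (hy : y < o) : ∃ z ∈ C, y < z := by
  rw [← hC.1.2] at hy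
  refine exists_lt_of_lt_csSup ?_ hy
  rw [Set.nonempty_iff_ne_empty]
  rintro rfl
  simp at hy

theorem IsClubIn.mem_of_forall_lt {o : Ordinal.{u}} {C : Set Ordinal.{u}} (hC : IsClubIn o C)
    {δ : Ordinal.{u}} (hδ : δ < o) (hδ₀ : 0 < δ) (h : ∀ y < δ, ∃ z ∈ C, y < z ∧ z < δ) :
    δ ∈ C := by
  have hne : (C ∩ Set.Iio δ).Nonempty := by
    obtain ⟨z, hz, -, hzδ⟩ := h 0 hδ₀
    exact ⟨z, hz, hzδ⟩
  have hs : sSup (C ∩ Set.Iio δ) = δ := by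
    refine csSup_eq_of_forall_le_of_forall_lt_exists_gt hne (fun z hz ↦ hz.2.le) fun y hy ↦ ?_
    obtain ⟨z, hz, hyz, hzδ⟩ := h y hy
    exact ⟨z, ⟨hz, hzδ⟩, hyz⟩
  have := hC.2 (C ∩ Set.Iio δ) Set.inter_subset_left hne (hs.trans_lt hδ)
  rwa [hs] at this

/-- Fewer than `κ` clubs in a regular cardinal `κ` have a common point of any prescribed regular
cofinality `μ < κ` that is moreover closed under a given self-map of `κ`. -/
theorem exists_mem_clubs_of_cof {κ μ : Cardinal.{u}} (hκ : κ.IsRegular) (hμ : μ.IsRegular)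
    (hμκ : μ < κ) {ι : Type u} (hι : #ι < κ) (C : ι → Set Ordinal.{u})
    (hC : ∀ i, IsClubIn κ.ord (C i)) (f : Ordinal.{u} → Ordinal.{u})
    (hf : ∀ y < κ.ord, f y < κ.ord) :
    ∃ δ < κ.ord, δ.cof = μ ∧ (∀ i, δ ∈ C i) ∧ ∀ y < δ, f y < δ := by
  have hnext : ∀ i y, ∃ z, y < κ.ord → z ∈ C i ∧ y < z := fun i y ↦ by
    by_cases hy : y < κ.ord
    · obtain ⟨z, hz⟩ := (hC i).exists_gt hy
      exact ⟨z, fun _ ↦ hz⟩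
    · exact ⟨0, fun h ↦ absurd h hy⟩
  choose n hn using hnext
  obtain ⟨δ, hδ, hcof, hcl⟩ := exists_closed_of_cof hκ hμ hμκ
    (fun y ↦ max (f y) (⨆ i, n i y + 1)) fun y hy ↦ max_lt (hf y hy) <|
      Ordinal.iSup_add_one_lt_of_lt_cof (by rwa [hκ.cof_ord]) fun i ↦
        (hC i).1.1 (hn i y hy).1
  refine ⟨δ, hδ, hcof, fun i ↦ ?_, fun y hy ↦ (le_max_left _ _).trans_lt (hcl y hy)⟩
  refine (hC i).mem_of_forall_lt hδ ?_ fun y hy ↦ ⟨n i y, (hn i y (hy.trans hδ)).1,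
    (hn i y (hy.trans hδ)).2, ?_⟩
  · rw [← Ordinal.cof_pos, hcof]
    exact hμ.pos
  · exact ((Ordinal.lt_iSup_add_one (fun i ↦ n i y) i).trans_le (le_max_right _ _)).trans
      (hcl y hy)

/-- A map between linear orders of different cofinality is bounded on a cofinal set. -/
theorem exists_isCofinal_setOf_lt {P : Type u} {Q : Type v} [LinearOrder P] [LinearOrder Q]
    [NoMaxOrder Q] (h : Cardinal.lift.{v} (Order.cof P) ≠ Cardinal.lift.{u} (Order.cof Q))
    (g : P → Q) : ∃ j, IsCofinal {y | g y < j} := by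
  by_contra! hcon
  simp only [not_isCofinal_iff, Set.mem_ofPred_eq] at hcon
  choose b hb using hcon
  obtain h | h := h.lt_or_gt
  · obtain ⟨s, hs, hsc⟩ := Order.exists_cof_eq P
    have : ¬ IsCofinal (g '' s) := fun hc ↦ by
      have h₁ := Cardinal.lift_le.{u}.2 (Order.cof_le hc)
      have h₂ : Cardinal.lift.{u} #(g '' s) ≤ Cardinal.lift.{v} #s := Cardinal.mk_image_le_lift
      rw [hsc] at h₂
      exact (h₁.trans h₂).not_gt h
    obtain ⟨j, hj⟩ := not_isCofinal_iff.1 this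
    obtain ⟨c, hc, hbc⟩ := hs (b j)
    exact (hb j c (hj _ ⟨c, hc, rfl⟩)).not_ge hbc
  · obtain ⟨s, hs, hsc⟩ := Order.exists_cof_eq Q
    have : ¬ IsCofinal (b '' s) := fun hc ↦ by
      have h₁ := Cardinal.lift_le.{v}.2 (Order.cof_le hc)
      have h₂ : Cardinal.lift.{v} #(b '' s) ≤ Cardinal.lift.{u} #s := Cardinal.mk_image_le_lift
      rw [hsc] at h₂
      exact (h₁.trans h₂).not_gt h
    obtain ⟨a, ha⟩ := not_isCofinal_iff.1 this
    obtain ⟨q, hq⟩ := exists_gt (g a)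
    obtain ⟨d, hd, hqd⟩ := hs q
    exact (hb d a (hq.trans_le hqd)).not_gt (ha _ ⟨d, hd, rfl⟩)

/-- Dependent choice along a well-order, for a relation that only looks at earlier values. -/
theorem exists_forall_of_congr_lt {T : Type u} {S : Type v} [LinearOrder T] [WellFoundedLT T]
    [Nonempty S] (P : T → (T → S) → S → Prop)
    (hP : ∀ τ z z', (∀ σ < τ, z σ = z' σ) → ∀ s, P τ z s → P τ z' s)
    (h : ∀ τ z, ∃ s, P τ z s) : ∃ z : T → S, ∀ τ, P τ z (z τ) := by
  classical
  choose F hF using h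
  let z : T → S := WellFoundedLT.fix
    fun τ r ↦ F τ fun σ ↦ if hσ : σ < τ then r σ hσ else Classical.arbitrary S
  have hz : ∀ τ, z τ = F τ fun σ ↦ if σ < τ then z σ else Classical.arbitrary S := fun τ ↦ by
    simp only [z]
    rw [WellFoundedLT.fix_eq]
    simp
  refine ⟨z, fun τ ↦ hP τ (fun σ ↦ if σ < τ then z σ else Classical.arbitrary S) z
    (fun σ hσ ↦ if_pos hσ) _ ?_⟩
  rw [hz τ]
  exact hF _ _

end ClosurePoints

section Coding

open Order

universe u

theorem exists_injOn_Iio {θ : Cardinal.{u}} (hθ : ℵ₀ ≤ θ) :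
    ∃ e : Ordinal.{u} → Ordinal.{u} → θ.ord.ToType,
      ∀ δ < (Order.succ θ).ord, Set.InjOn (e δ) (Set.Iio δ) := by
  have : Nonempty θ.ord.ToType := by
    rw [← Cardinal.mk_ne_zero_iff, Cardinal.mk_ord_toType]
    exact (Cardinal.aleph0_pos.trans_le hθ).ne'
  have h : ∀ δ : Ordinal.{u}, ∃ e : Ordinal.{u} → θ.ord.ToType,
      δ < (Order.succ θ).ord → Set.InjOn e (Set.Iio δ) := fun δ ↦ by
    by_cases hδ : δ < (Order.succ θ).ord
    · have hle : Cardinal.lift.{u} #(Set.Iio δ) ≤ Cardinal.lift.{u + 1} #θ.ord.ToType := by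
        rw [Cardinal.mk_Iio_ordinal, Cardinal.mk_ord_toType]
        rw [Cardinal.lift_lift]
        exact Cardinal.lift_le.2 (Order.lt_succ_iff.1 (Cardinal.lt_ord.1 hδ))
      obtain ⟨i⟩ := Cardinal.lift_mk_le'.1 hle
      classical
      refine ⟨fun y ↦ if hy : y < δ then i ⟨y, hy⟩ else Classical.arbitrary _,
        fun _ a ha b hb hab ↦ ?_⟩
      rw [Set.mem_Iio] at ha hb
      simp only [ha, hb, dif_pos] at hab
      exact congrArg Subtype.val (i.injective hab)
    · exact ⟨fun _ ↦ Classical.arbitrary _, fun h ↦ absurd h hδ⟩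
  choose e he using h
  exact ⟨e, he⟩

/-- If `2 ^ θ = θ⁺`, then the initial parts of `θ × θ`-indexed families of sets of ordinals below
`θ⁺` can be enumerated in order type `θ⁺`. -/
theorem exists_enumeration_initial_parts {θ : Cardinal.{u}} (hθ : ℵ₀ ≤ θ)
    (hch : 2 ^ θ = Order.succ θ) :
    ∃ X : Ordinal.{u} → θ.ord.ToType → θ.ord.ToType → Set Ordinal.{u},
      ∀ (Z : θ.ord.ToType → θ.ord.ToType → Set Ordinal.{u}), ∀ α < (Order.succ θ).ord,
        ∃ β < (Order.succ θ).ord, ∀ j τ, X β j τ ∩ Set.Iio α = Z j τ ∩ Set.Iio α := by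
  obtain ⟨e, he⟩ := exists_injOn_Iio hθ
  let T := θ.ord.ToType
  have hT : #T = θ := Cardinal.mk_ord_toType θ
  let K : Type u := (Order.succ θ).ord.ToType × (T → T → Set T)
  have hK : #K = Order.succ θ := by
    have : #(T → T → Set T) = Order.succ θ := by
      rw [← Cardinal.power_def, ← Cardinal.power_def, Cardinal.mk_set, hT, ← Cardinal.power_mul,
        ← Cardinal.power_mul, Cardinal.mul_eq_self hθ, Cardinal.mul_eq_self hθ, hch]
    rw [Cardinal.mk_prod, this, Cardinal.mk_ord_toType, Cardinal.lift_id,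
      Cardinal.mul_eq_self (hθ.trans (Order.le_succ θ))]
  have hlift : Cardinal.lift.{u} #(Set.Iio (Order.succ θ).ord) = Cardinal.lift.{u + 1} #K := by
    rw [Cardinal.mk_Iio_ordinal, hK]
    simp
  obtain ⟨k⟩ := Cardinal.lift_mk_eq'.1 hlift
  obtain ⟨r⟩ : Nonempty ((Order.succ θ).ord.ToType ≃ Set.Iio (Order.succ θ).ord) := by
    apply Cardinal.lift_mk_eq'.1
    rw [Cardinal.mk_Iio_ordinal]
    simp
  classical
  let D : K → T → T → Set Ordinal.{u} := fun p j τ ↦ {x | x < (r p.1).1 ∧ e (r p.1).1 x ∈ p.2 j τ}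
  refine ⟨fun β j τ ↦ if hβ : β < (Order.succ θ).ord then D (k ⟨β, hβ⟩) j τ else ∅,
    fun Z α hα ↦ ?_⟩
  let p : K := (r.symm ⟨α, hα⟩, fun j τ ↦ e α '' (Z j τ ∩ Set.Iio α))
  refine ⟨(k.symm p).1, (k.symm p).2, fun j τ ↦ ?_⟩
  have hk : (k.symm p).1 < (Order.succ θ).ord := (k.symm p).2
  have hkp : k ⟨(k.symm p).1, hk⟩ = p := k.apply_symm_apply p
  ext x
  simp only [dif_pos hk, hkp]
  simp only [Equiv.apply_symm_apply, D, p, Set.mem_inter_iff, Set.mem_ofPred_eq,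
    Set.mem_Iio]
  constructor
  · rintro ⟨⟨hx, y, ⟨hy, hyα⟩, hxy⟩, -⟩
    obtain rfl := he α hα hyα hx hxy
    exact ⟨hy, hx⟩
  · rintro ⟨hx, hxα⟩
    exact ⟨⟨hxα, x, ⟨hx, hxα⟩, rfl⟩, hxα⟩

theorem exists_isRegular_lt_succ_ne_cof {θ : Cardinal.{u}} (hθ : ℵ₀ < θ) :
    ∃ μ : Cardinal.{u}, μ.IsRegular ∧ μ < Order.succ θ ∧ μ ≠ θ.ord.cof := by
  by_cases h : θ.ord.cof = ℵ₀
  · refine ⟨ℵ₁, Cardinal.isRegular_aleph_one, Order.lt_succ_of_le ?_, ?_⟩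
    · rw [← Cardinal.succ_aleph0]
      exact Order.succ_le_of_lt hθ
    · rw [h]
      exact Cardinal.aleph0_lt_aleph_one.ne'
  · exact ⟨ℵ₀, Cardinal.isRegular_aleph0, Order.lt_succ_of_le hθ.le, Ne.symm h⟩

end Coding

section Guessing

universe u

variable {T : Type u} [LinearOrder T]

/-- The pairs `(α, β)` of ordinals below `δ`, of rank less than `j` in the enumeration `e δ`, such
that `X β σ` agrees with `z σ` below `α` for every `σ < τ`. -/
def agreeingPairs (e : Ordinal.{u} → Ordinal.{u} → T)
    (X : Ordinal.{u} → T → Set Ordinal.{u}) (j : T) (z : T → Set Ordinal.{u}) (τ : T)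
    (δ : Ordinal.{u}) : Set (Ordinal.{u} × Ordinal.{u}) :=
  {p | (p.1 < δ ∧ e δ p.1 < j) ∧ (p.2 < δ ∧ e δ p.2 < j) ∧
    ∀ σ < τ, X p.2 σ ∩ Set.Iio p.1 = z σ ∩ Set.Iio p.1}

/-- The guess at `δ` assembled from the agreeing pairs. -/
def guess (e : Ordinal.{u} → Ordinal.{u} → T)
    (X : Ordinal.{u} → T → Set Ordinal.{u}) (j : T) (z : T → Set Ordinal.{u}) (τ : T)
    (δ : Ordinal.{u}) : Set Ordinal.{u} :=
  ⋃ p ∈ agreeingPairs e X j z τ δ, X p.2 τ ∩ Set.Iio p.1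

theorem guess_subset (e : Ordinal.{u} → Ordinal.{u} → T)
    (X : Ordinal.{u} → T → Set Ordinal.{u}) (j : T) (z : T → Set Ordinal.{u}) (τ : T)
    (δ : Ordinal.{u}) : guess e X j z τ δ ⊆ Set.Iio δ := by
  refine Set.iUnion₂_subset fun p hp x hx ↦ ?_
  exact lt_trans hx.2 hp.1.1

theorem guess_congr (e : Ordinal.{u} → Ordinal.{u} → T)
    (X : Ordinal.{u} → T → Set Ordinal.{u}) (j : T) {z z' : T → Set Ordinal.{u}} {τ : T}
    (h : ∀ σ < τ, z σ = z' σ) : guess e X j z τ = guess e X j z' τ := by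
  have : agreeingPairs e X j z τ = agreeingPairs e X j z' τ := by
    ext δ p
    simp +contextual [agreeingPairs, h]
  unfold guess
  rw [this]

theorem guess_eq_of_forall_agree {e : Ordinal.{u} → Ordinal.{u} → T}
    {X : Ordinal.{u} → T → Set Ordinal.{u}} {j : T} {z : T → Set Ordinal.{u}} {τ : T}
    {δ : Ordinal.{u}}
    (hcof : ∀ y < δ, ∃ p ∈ agreeingPairs e X j z τ δ, y < p.1)
    (h : ∀ p ∈ agreeingPairs e X j z τ δ, X p.2 τ ∩ Set.Iio p.1 = z τ ∩ Set.Iio p.1) :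
    guess e X j z τ δ = z τ ∩ Set.Iio δ := by
  ext x
  simp only [guess, Set.mem_iUnion, exists_prop]
  constructor
  · rintro ⟨p, hp, hx⟩
    rw [h p hp] at hx
    exact ⟨hx.1, lt_trans hx.2 hp.1.1⟩
  · rintro ⟨hx, hxδ⟩
    obtain ⟨p, hp, hxp⟩ := hcof x hxδ
    refine ⟨p, hp, ?_⟩
    rw [h p hp]
    exact ⟨hx, hxp⟩

/-- If some family `X (f α)` agrees with `z` below `α` for cofinally many `α < δ` of rank less
than `j`, then one of the guesses at `δ` is correct, as soon as `T` has more elements than there are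
pairs below `j`. -/
theorem exists_guess_eq {e : Ordinal.{u} → Ordinal.{u} → T}
    {X : Ordinal.{u} → T → Set Ordinal.{u}} {j : T} {z : T → Set Ordinal.{u}}
    {δ : Ordinal.{u}} (he : Set.InjOn (e δ) (Set.Iio δ)) (hj : #(Set.Iio j × Set.Iio j) < #T)
    {f : Ordinal.{u} → Ordinal.{u}} (hf : ∀ y < δ, f y < δ)
    (hfX : ∀ y < δ, ∀ σ, X (f y) σ ∩ Set.Iio y = z σ ∩ Set.Iio y)
    (hcof : ∀ y < δ, ∃ α < δ, y < α ∧ e δ α < j ∧ e δ (f α) < j) :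
    ∃ τ, guess e X j z τ δ = z τ ∩ Set.Iio δ := by
  by_contra! hne
  have hpair : ∀ τ, ∃ p ∈ agreeingPairs e X j z τ δ,
      X p.2 τ ∩ Set.Iio p.1 ≠ z τ ∩ Set.Iio p.1 := fun τ ↦ by
    by_contra! hcon
    refine hne τ (guess_eq_of_forall_agree (fun y hy ↦ ?_) hcon)
    obtain ⟨α, hα, hyα, hjα, hjf⟩ := hcof y hy
    exact ⟨(α, f α), ⟨⟨hα, hjα⟩, ⟨hf α hα, hjf⟩, fun σ _ ↦ hfX α hα σ⟩, hyα⟩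
  choose p hp hpne using hpair
  let q : T → Set.Iio j × Set.Iio j := fun τ ↦
    (⟨e δ (p τ).1, (hp τ).1.2⟩, ⟨e δ (p τ).2, (hp τ).2.1.2⟩)
  have hpq : ∀ σ τ, q σ = q τ → p σ = p τ := fun σ τ h ↦ by
    have h₁ : e δ (p σ).1 = e δ (p τ).1 := congrArg (fun x ↦ x.1.1) h
    have h₂ : e δ (p σ).2 = e δ (p τ).2 := congrArg (fun x ↦ x.2.1) h
    exact Prod.ext (he (hp σ).1.1 (hp τ).1.1 h₁) (he (hp σ).2.1.1 (hp τ).2.1.1 h₂)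
  have hlt : ∀ σ τ, σ < τ → q σ ≠ q τ := fun σ τ hστ h ↦ by
    refine hpne σ ?_
    rw [hpq σ τ h]
    exact (hp τ).2.2 σ hστ
  have hq : Function.Injective q := fun σ τ h ↦ by
    by_contra hστ
    obtain hlt' | hlt' := lt_or_gt_of_ne hστ
    · exact hlt _ _ hlt' h
    · exact hlt _ _ hlt' h.symm
  exact (Cardinal.mk_le_of_injective hq).not_gt hj

theorem exists_club_of_not_diamond {o : Ordinal.{u}} (h : ¬ Diamond o)
    (A : Ordinal.{u} → Set Ordinal.{u}) (hA : ∀ δ, A δ ⊆ Set.Iio δ) :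
    ∃ Z C : Set Ordinal.{u}, IsClubIn o C ∧ ∀ δ ∈ C, A δ ≠ Z ∩ Set.Iio δ := by
  by_contra! hcon
  refine h ⟨fun α ↦ A α, fun α ↦ hA α, fun Z _ ↦ ⟨fun β hβ ↦ hβ.1, fun C hC ↦ ?_⟩⟩
  obtain ⟨δ, hδ, hA⟩ := hcon Z C hC
  exact ⟨δ, ⟨hC.1.1 hδ, hA⟩, hδ⟩

end Guessing

theorem diamond_succ_of_continuum_hypothesis (θ : Cardinal)
    (hθ : Cardinal.aleph0 < θ)
    (hch : 2 ^ θ = Order.succ θ) : Diamond (Order.succ θ).ord := by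
  by_contra hnd
  have hκ : (Order.succ θ).IsRegular := Cardinal.isRegular_succ hθ.le
  have hlim := Cardinal.isSuccLimit_ord hθ.le
  obtain ⟨e, he⟩ := exists_injOn_Iio hθ.le
  obtain ⟨X, hX⟩ := exists_enumeration_initial_parts hθ.le hch
  obtain ⟨μ, hμ, hμκ, hμθ⟩ := exists_isRegular_lt_succ_ne_cof hθ
  have hT : #θ.ord.ToType = θ := Cardinal.mk_ord_toType θ
  have : NoMaxOrder θ.ord.ToType := Cardinal.noMaxOrder hθ.le
  have hZ : ∀ j : θ.ord.ToType, ∃ z : θ.ord.ToType → Set Ordinal, ∀ τ, ∃ C,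
      IsClubIn (Order.succ θ).ord C ∧
      ∀ δ ∈ C, guess e (X · j) j z τ δ ≠ z τ ∩ Set.Iio δ := fun j ↦
    exists_forall_of_congr_lt
      (fun τ z s ↦ ∃ C, IsClubIn (Order.succ θ).ord C ∧
        ∀ δ ∈ C, guess e (X · j) j z τ δ ≠ s ∩ Set.Iio δ)
      (fun τ z z' h s hs ↦ by rwa [guess_congr e (X · j) j h] at hs)
      (fun τ z ↦ exists_club_of_not_diamond hnd _ (guess_subset e (X · j) j z τ))
  choose Z C hC hCne using hZ
  have hf : ∀ α, ∃ β, α < (Order.succ θ).ord → β < (Order.succ θ).ord ∧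
      ∀ j τ, X β j τ ∩ Set.Iio α = Z j τ ∩ Set.Iio α := fun α ↦ by
    by_cases hα : α < (Order.succ θ).ord
    · obtain ⟨β, hβ⟩ := hX Z α hα
      exact ⟨β, fun _ ↦ hβ⟩
    · exact ⟨0, fun h ↦ absurd h hα⟩
  choose f hf using hf
  obtain ⟨δ, hδ, hcof, hδC, hδf⟩ := exists_mem_clubs_of_cof hκ hμ hμκ
    (ι := θ.ord.ToType × θ.ord.ToType)
    (by
      rw [Cardinal.mk_prod, Cardinal.lift_id, hT, Cardinal.mul_eq_self hθ.le]
      exact Order.lt_succ θ)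
    (fun p ↦ C p.1 p.2) (fun p ↦ hC p.1 p.2) f (fun y hy ↦ (hf y hy).1)
  have hδlim : Order.IsSuccLimit δ := by
    rw [← Ordinal.one_lt_cof_iff, hcof]
    exact_mod_cast hμ.nat_lt 1
  obtain ⟨j, hj⟩ := exists_isCofinal_setOf_lt (P := Set.Iio δ) (Q := θ.ord.ToType)
    (by
      rw [Ordinal.cof_Iio, ← Ordinal.lift_cof, Ordinal.cof_toType, hcof]
      simpa only [Cardinal.lift_lift] using Cardinal.lift_injective.ne hμθ)
    (fun y ↦ max (e δ y) (e δ (f y)))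
  obtain ⟨τ, hτ⟩ := exists_guess_eq (X := (X · j)) (z := Z j) (j := j) (he δ hδ)
    (by
      rw [Cardinal.mk_prod, Cardinal.lift_id, hT]
      have hlt : #(Set.Iio j) < θ := (Cardinal.mk_Iio_lt j (by simp)).trans_eq hT
      exact Cardinal.mul_lt_of_lt hθ.le hlt hlt)
    hδf (fun y hy σ ↦ (hf y (hy.trans hδ)).2 j σ)
    (fun y hy ↦ by
      obtain ⟨α, hα, hle⟩ := hj ⟨Order.succ y, hδlim.succ_lt hy⟩
      exact ⟨α.1, α.2, (Order.lt_succ y).trans_le hle, max_lt_iff.1 hα⟩)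
  exact hCne j τ δ (hδC (j, τ)) hτ

end WDP
end
end

section
/- Let λ be a regular uncountable cardinal. Then the very weak diamond Ψ_λ holds if and only if 2^{<λ} < 2^λ, where 2^{<λ} = sup{2^θ : θ < λ, θ a cardinal}. -/
noncomputable section

open Cardinal Set

namespace WDP

universe u

theorem IsUnboundedIn.of_forall_exists_le {o : Ordinal} {S : Set Ordinal} (ho : Order.IsSuccLimit o)
    (hS : S ⊆ Set.Iio o) (h : ∀ α < o, ∃ β ∈ S, α ≤ β) : IsUnboundedIn o S := by
  have hbdd : BddAbove S := ⟨o, fun β hβ => (hS hβ).le⟩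
  refine ⟨hS, le_antisymm (csSup_le' fun β hβ => (hS hβ).le) ?_⟩
  by_contra! hlt
  obtain ⟨β, hβ, hle⟩ := h _ (ho.succ_lt hlt)
  exact (Order.succ_le_iff.mp hle).not_ge (le_csSup hbdd hβ)

theorem not_isUnboundedIn_of_subset_Iio {o θ : Ordinal} {S : Set Ordinal} (hθ : θ < o)
    (hS : S ⊆ Set.Iio θ) : ¬ IsUnboundedIn o S := fun h =>
  ((csSup_le' fun _ hβ => (hS hβ).le).trans_lt hθ).ne h.2

theorem guessSet_subset_Iio (o : Ordinal) (c : Coloring o) (f g : Set.Iio o → Bool) :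
    guessSet o c f g ⊆ Set.Iio o := fun _ ⟨h, _⟩ => h

theorem exists_eventually_eq_not_of_not_isUnboundedIn {o : Ordinal} (ho : Order.IsSuccLimit o)
    {c : Coloring o} {f g : Set.Iio o → Bool} (h : ¬ IsUnboundedIn o (guessSet o c f g)) :
    ∃ α < o, ∀ β : Set.Iio o, α ≤ β.1 → g β = !c β (restr f β) := by
  by_contra! hc
  refine h (.of_forall_exists_le ho (guessSet_subset_Iio o c f g) fun α hα => ?_)
  obtain ⟨β, hle, hne⟩ := hc α hα
  exact ⟨β.1, ⟨β.2, (Bool.eq_not.not_left.mp hne).symm⟩, hle⟩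

/-- If every function is eventually computed by `d` from the initial segments of some other function,
then iterating this `ω` times codes a function by countably many functions with bounded domain. -/
theorem exists_injective_of_forall_eventually_eq {o : Ordinal} (ho : ℵ₀ < o.cof) (d : Coloring o)
    (h : ∀ g : Set.Iio o → Bool, ∃ f : Set.Iio o → Bool,
      ∃ α < o, ∀ β : Set.Iio o, α ≤ β.1 → g β = d β (restr f β)) :
    ∃ Φ : (Set.Iio o → Bool) → Σ δ : Set.Iio o, ℕ → Set.Iio δ.1 → Bool,
      Function.Injective Φ := by
  choose F a ha hF using h
  let δ (g : Set.Iio o → Bool) : Set.Iio o :=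
    ⟨⨆ n : ℕ, a (F^[n] g), Ordinal.lift_iSup_lt_of_lt_cof
      (by simpa using ho) fun n => ha _⟩
  have hδ (g) (n : ℕ) : a (F^[n] g) ≤ (δ g).1 :=
    Ordinal.le_iSup (fun n : ℕ => a (F^[n] g)) n
  refine ⟨fun g => ⟨δ g, fun n => restr (F^[n] g) (δ g)⟩, fun g g' hgg' => ?_⟩
  obtain ⟨hδδ, hres⟩ := Sigma.mk.inj hgg'
  have hlt (n : ℕ) (β : Set.Iio o) (hβ : β.1 < (δ g).1) : F^[n] g β = F^[n] g' β := by
    rw [← hδδ] at hres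
    exact congrFun (congrFun (eq_of_heq hres) n) ⟨β.1, hβ⟩
  have key (β : Ordinal) : ∀ (hβ : β < o) (n : ℕ), F^[n] g ⟨β, hβ⟩ = F^[n] g' ⟨β, hβ⟩ := by
    induction β using WellFoundedLT.induction with
    | ind β ih =>
      intro hβ n
      obtain hlt' | hge := lt_or_ge β (δ g).1
      · exact hlt n ⟨β, hβ⟩ hlt'
      · rw [hF _ ⟨β, hβ⟩ ((hδ g n).trans hge), hF _ ⟨β, hβ⟩ ((hδ g' n).trans (hδδ ▸ hge))]
        congr 1
        funext γ
        simp only [restr, ← Function.iterate_succ_apply' F]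
        exact ih γ.1 γ.2 _ (n + 1)
  funext β
  exact key β.1 β.2 0

theorem le_powerlt_two (κ : Cardinal) : κ ≤ powerlt 2 κ :=
  le_of_forall_lt fun _ hx => (cantor _).trans_le (le_powerlt 2 hx)

theorem mk_sigma_nat_arrow_Iio_le {κ : Cardinal.{u}} (hκ : ℵ₀ < κ) :
    #(Σ δ : Set.Iio κ.ord, ℕ → Set.Iio δ.1 → Bool) ≤ lift.{u + 1} (powerlt 2 κ) := by
  have hle : κ ≤ powerlt 2 κ := le_powerlt_two κ
  calc #(Σ δ : Set.Iio κ.ord, ℕ → Set.Iio δ.1 → Bool)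
      ≤ sum fun _ : Set.Iio κ.ord => lift.{u + 1} (powerlt 2 κ) := by
        rw [mk_sigma]
        refine sum_le_sum _ _ fun δ => ?_
        have hδ : δ.1.card * ℵ₀ < κ := mul_lt_of_lt hκ.le (lt_ord.mp δ.2) hκ
        have := lift_le.{u + 1}.mpr (le_powerlt 2 hδ)
        simpa [mk_Iio_ordinal, ← power_mul] using this
    _ = lift.{u + 1} (κ * powerlt 2 κ) := by simp [mk_Iio_ordinal]
    _ ≤ lift.{u + 1} (powerlt 2 κ) := by
        rw [lift_le, mul_eq_max_of_aleph0_le_left hκ.le (aleph0_pos.trans_le (hκ.le.trans hle)).ne', max_eq_right hle]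

theorem mk_Iio_ord_arrow_bool (κ : Cardinal.{u}) :
    #(Set.Iio κ.ord → Bool) = lift.{u + 1} (2 ^ κ) := by
  simp [mk_Iio_ordinal]

theorem veryWeakDiamond_of_powerlt_lt {κ : Cardinal} (hreg : κ.IsRegular) (hunc : ℵ₀ < κ)
    (h : powerlt 2 κ < 2 ^ κ) : VeryWeakDiamond κ.ord := by
  by_contra hc
  simp only [VeryWeakDiamond, not_forall, not_exists] at hc
  obtain ⟨c, hc⟩ := hc
  obtain ⟨Φ, hΦ⟩ := exists_injective_of_forall_eventually_eq (hreg.cof_ord.symm ▸ hunc)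
    (fun β t => !c β t) fun g => (hc g).imp fun _ =>
      exists_eventually_eq_not_of_not_isUnboundedIn (isSuccLimit_ord hreg.aleph0_le)
  have hle := (mk_le_of_injective hΦ).trans (mk_sigma_nat_arrow_Iio_le hunc)
  rw [mk_Iio_ord_arrow_bool, lift_le] at hle
  exact h.not_ge hle

theorem exists_two_power_le_of_le_powerlt {κ : Cardinal.{u}} (hκ : ℵ₀ ≤ κ)
    (h : 2 ^ κ ≤ powerlt 2 κ) : ∃ θ < κ, (2 : Cardinal) ^ κ ≤ 2 ^ θ := by
  by_contra! hlt
  refine h.not_gt (lift_iSup_lt_of_lt_cof_ord ?_ fun θ : Set.Iio κ => hlt θ.1 θ.2)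
  have hcard : #(Set.Iio κ) ≤ lift.{u + 1} κ := by
    have := mk_le_of_injective (f := fun θ : Set.Iio κ =>
      (⟨θ.1.ord, ord_lt_ord.mpr θ.2⟩ : Set.Iio κ.ord)) fun θ θ' hθ =>
        Subtype.ext (ord_injective (congrArg Subtype.val hθ))
    rwa [mk_Iio_ordinal, card_ord] at this
  rw [lift_two_power]
  refine lt_of_le_of_lt ?_ (lt_cof_ord_power (by simpa using hκ) one_lt_two)
  rwa [lift_id'.{u, u + 1}]

theorem not_veryWeakDiamond_of_two_power_le {κ θ : Cardinal.{u}} (hθ : θ < κ)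
    (h : (2 : Cardinal) ^ κ ≤ 2 ^ θ) : ¬ VeryWeakDiamond κ.ord := by
  have hle : #(Set.Iio κ.ord → Bool) ≤ #(Set.Iio θ.ord → Bool) := by
    rwa [mk_Iio_ord_arrow_bool, mk_Iio_ord_arrow_bool, lift_le]
  obtain ⟨φ⟩ := hle
  intro hΨ
  obtain ⟨g, hg⟩ := hΨ fun α t =>
    if hα : θ.ord ≤ α.1 then
      !Function.invFun φ (fun i => t ⟨i.1, lt_of_lt_of_le (Set.mem_Iio.mp i.2) hα⟩) α
    else true
  refine not_isUnboundedIn_of_subset_Iio (ord_lt_ord.mpr hθ) ?_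
    (hg fun β => if hβ : β.1 < θ.ord then φ g ⟨β.1, hβ⟩ else true)
  rintro β ⟨hβ, heq⟩
  by_contra hge
  have hge' : θ.ord ≤ β := not_lt.mp hge
  have hrestr : (fun i : Set.Iio θ.ord => restr (o := κ.ord)
      (fun β => if hβ : β.1 < θ.ord then φ g ⟨β.1, hβ⟩ else true) ⟨β, hβ⟩
      ⟨i.1, lt_of_lt_of_le (Set.mem_Iio.mp i.2) hge'⟩) = φ g := by
    funext i
    exact dif_pos i.2
  beta_reduce at heq
  rw [dif_pos hge', hrestr, Function.leftInverse_invFun φ.injective] at heq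
  exact Bool.not_ne_self _ heq

theorem veryWeakDiamond_iff_powerlt_lt (lam : Cardinal)
    (hreg : lam.IsRegular) (hunc : Cardinal.aleph0 < lam) :
    VeryWeakDiamond lam.ord ↔ Cardinal.powerlt 2 lam < 2 ^ lam := by
  refine ⟨fun hΨ => ?_, veryWeakDiamond_of_powerlt_lt hreg hunc⟩
  by_contra! hle
  obtain ⟨θ, hθ, h⟩ := exists_two_power_le_of_le_powerlt hunc.le hle
  exact not_veryWeakDiamond_of_two_power_le hθ h hΨ

end WDP
end
end

section
/- Let λ be a regular uncountable cardinal. If 2^{<λ} = 2^λ (where 2^{<λ} = sup{2^θ : θ < λ, θ a cardinal}) then the weak diamond Φ_λ fails, and a fortiori the diamond principle ◊_λ fails. -/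
noncomputable section

open Cardinal Set

namespace WDP

universe u

theorem sSup_Ico_of_isSuccLimit {a o : Ordinal} (ho : Order.IsSuccLimit o) (ha : a < o) :
    sSup (Set.Ico a o) = o := by
  refine csSup_eq_of_forall_le_of_forall_lt_exists_gt ⟨a, le_rfl, ha⟩ (fun b hb => hb.2.le) ?_
  intro w hw
  exact ⟨Order.succ (max a w), ⟨(le_max_left a w).trans (Order.le_succ _),
    ho.succ_lt (max_lt ha hw)⟩, Order.lt_succ_of_le (le_max_right a w)⟩

theorem isClubIn_Ico {a o : Ordinal} (ho : Order.IsSuccLimit o) (ha : a < o) :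
    IsClubIn o (Set.Ico a o) := by
  refine ⟨⟨fun b hb => hb.2, sSup_Ico_of_isSuccLimit ho ha⟩, fun s hs hne hlt => ⟨?_, hlt⟩⟩
  obtain ⟨x, hx⟩ := hne
  exact (hs hx).1.trans (le_csSup ⟨o, fun y hy => (hs hy).2.le⟩ hx)

theorem IsStationaryIn.mono {o : Ordinal} {S T : Set Ordinal} (hS : IsStationaryIn o S)
    (hST : S ⊆ T) (hT : T ⊆ Set.Iio o) : IsStationaryIn o T :=
  ⟨hT, fun C hC => (hS.2 C hC).mono (Set.inter_subset_inter_left C hST)⟩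

/-- The diamond principle implies the weak diamond. -/
theorem Diamond.weakDiamond {o : Ordinal} (h : Diamond o) : WeakDiamond o := by
  classical
  obtain ⟨A, -, hA⟩ := h
  intro c
  refine ⟨fun α => c α fun β => decide (β.1 ∈ A α), fun f => ?_⟩
  refine (hA {β | ∃ hβ : β < o, f ⟨β, hβ⟩ = true} fun β hβ => hβ.1).mono ?_ fun β hβ => hβ.1
  rintro α ⟨hα, hAα⟩
  refine ⟨hα, congrArg (c ⟨α, hα⟩) (funext fun β => ?_)⟩
  have hβ : β.1 < α := β.2
  have hβo : β.1 < o := hβ.trans hα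
  simp [restr, hAα, hβo]

/-- If the supremum `2^{<κ}` equals `2^κ`, then it is attained. -/
theorem exists_two_power_eq_of_powerlt_eq {κ : Cardinal.{u}} (hκ : ℵ₀ ≤ κ)
    (h : Cardinal.powerlt 2 κ = 2 ^ κ) : ∃ θ < κ, (2 : Cardinal) ^ θ = 2 ^ κ := by
  by_contra! hne
  have hlt : ∀ θ : Set.Iio κ, (2 : Cardinal) ^ θ.1 < 2 ^ κ := fun θ =>
    (Cardinal.power_le_power_left two_ne_zero (Set.mem_Iio.mp θ.2).le).lt_of_ne (hne θ.1 θ.2)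
  have hcard : #(Set.Iio κ) ≤ Cardinal.lift.{u + 1} κ := by
    have hinj := Cardinal.mk_le_of_injective
      (f := fun θ : Set.Iio κ => (⟨θ.1.ord, Cardinal.ord_lt_ord.mpr θ.2⟩ : Set.Iio κ.ord))
      fun x y hxy => Subtype.ext (Cardinal.ord_injective (congrArg Subtype.val hxy))
    rwa [Cardinal.mk_Iio_ordinal, Cardinal.card_ord] at hinj
  refine (Cardinal.lift_iSup_lt_of_lt_cof_ord ?_ hlt).ne h
  have hcof := Cardinal.lt_cof_ord_power (Cardinal.aleph0_le_lift.{u, u + 1}.mpr hκ)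
    Cardinal.one_lt_two
  rw [Cardinal.lift_power, Cardinal.lift_ofNat, Cardinal.lift_id'.{u, u + 1}]
  exact hcard.trans_lt hcof

/-- If `2^θ = 2^κ` for some `θ < κ`, then every `g : κ → 2` is avoided at all ordinals above `θ`
by the coloring which decodes from `f ↾ θ` a function `κ → 2`. -/
theorem not_weakDiamond_of_two_power_eq {κ θ : Cardinal} (hκ : ℵ₀ ≤ κ) (hθ : θ < κ)
    (h : (2 : Cardinal) ^ θ = 2 ^ κ) : ¬ WeakDiamond κ.ord := by
  have hθo : θ.ord < κ.ord := Cardinal.ord_lt_ord.mpr hθ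
  have hmk : #(Set.Iio θ.ord → Bool) = #(Set.Iio κ.ord → Bool) := by
    simpa [Cardinal.mk_Iio_ordinal] using congrArg Cardinal.lift h
  obtain ⟨Φ⟩ := Cardinal.eq.mp hmk
  intro hW
  obtain ⟨g, hg⟩ := hW fun α s =>
    if hα : θ.ord ≤ α.1 then Φ (fun β => s ⟨β.1, lt_of_lt_of_le β.2 hα⟩) α else false
  let f : Set.Iio κ.ord → Bool := fun β =>
    if hβ : β.1 < θ.ord then Φ.symm (fun α => !g α) ⟨β.1, hβ⟩ else false
  obtain ⟨α, ⟨hα, hc⟩, hθα, -⟩ :=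
    (hg f).2 _ (isClubIn_Ico (Cardinal.isSuccLimit_ord hκ) hθo)
  have hf : (fun β : Set.Iio θ.ord => restr f ⟨α, hα⟩ ⟨β.1, lt_of_lt_of_le β.2 hθα⟩) =
      Φ.symm fun α => !g α := by
    funext β
    have hβ : β.1 < θ.ord := β.2
    simp [restr, f, hβ]
  simp only [hθα, dite_true] at hc
  rw [hf, Equiv.apply_symm_apply] at hc
  simp at hc

theorem not_weakDiamond_of_powerlt_eq (lam : Cardinal)
    (hreg : lam.IsRegular) (hunc : Cardinal.aleph0 < lam)
    (h : Cardinal.powerlt 2 lam = 2 ^ lam) :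
    ¬ WeakDiamond lam.ord ∧ ¬ Diamond lam.ord := by
  obtain ⟨θ, hθ, hpow⟩ := exists_two_power_eq_of_powerlt_eq hunc.le h
  have hW : ¬ WeakDiamond lam.ord := not_weakDiamond_of_two_power_eq hunc.le hθ hpow
  exact ⟨hW, fun hD => hW hD.weakDiamond⟩

end WDP
end
end
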